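/- arXiv:1107.4713 — 2 statements merged into one kernel-verified Lean document; each statement's English description precedes it below -/
import Mathlib

section
/- Let F be an algebraically closed field of characteristic zero, G a group, and A a finite-dimensional G-simple G-graded F-algebra. Then there exists a multilinear G-graded polynomial p which is not a G-graded identity of A and which, for each g ∈ G with A_g ≠ 0, alternates in a set of exactly dim_F A_g variables of homogeneous degree g, these alternating sets being pairwise disjoint. -/
open scoped DirectSum

/-- A multiplicatively-indexed internal grading of an `F`-algebra `A` by the group `G`:
`A` is the internal direct sum of the subspaces `𝒜 g` and `𝒜 g * 𝒜 h ⊆ 𝒜 (g*h)`. -/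
structure IsGAlgGrading (F : Type*) [Field F] {G : Type*} [Group G] {A : Type*} [Ring A]
    [Algebra F A] [DecidableEq G] (𝒜 : G → Submodule F A) : Prop where
  isInternal : DirectSum.IsInternal 𝒜
  mul_mem : ∀ ⦃g h : G⦄ ⦃a b : A⦄, a ∈ 𝒜 g → b ∈ 𝒜 h → a * b ∈ 𝒜 (g * h)
/-- A `G`-graded algebra is `G`-simple if it is nonzero and its only two-sided ideals
generated by homogeneous elements are `⊥` and `⊤`. -/
def IsGSimpleAlg (F : Type*) [Field F] {G : Type*} [Group G] {A : Type*} [Ring A]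
    [Algebra F A] (𝒜 : G → Submodule F A) : Prop :=
  (∃ a : A, a ≠ 0) ∧
  ∀ I : TwoSidedIdeal A,
    (∀ a ∈ I, a ∈ Submodule.span F {x : A | (∃ g, x ∈ 𝒜 g) ∧ x ∈ I}) →
    I = ⊥ ∨ I = ⊤
/-- `p` is a `G`-graded identity of the graded algebra `(A, 𝒜)`: `p` vanishes under any
substitution sending the variable `(i, g)` (the `i`-th variable of degree `g`) to an
element of `𝒜 g`. -/
def IsGradedIdentity (F : Type*) [Field F] {G : Type*} [Group G] {A : Type*} [Ring A]
    [Algebra F A] (𝒜 : G → Submodule F A) (p : FreeAlgebra F (ℕ × G)) : Prop :=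
  ∀ v : ℕ × G → A, (∀ (i : ℕ) (g : G), v (i, g) ∈ 𝒜 g) →
    FreeAlgebra.lift F v p = 0

/-- The graded-variable swap: the algebra endomorphism of the free `G`-graded algebra
exchanging the variables `a` and `b`. -/
noncomputable def varSwap (F : Type*) [Field F] {G : Type*} [DecidableEq G]
    (a b : ℕ × G) : FreeAlgebra F (ℕ × G) →ₐ[F] FreeAlgebra F (ℕ × G) :=
  FreeAlgebra.lift F fun w => FreeAlgebra.ι F (Equiv.swap a b w)

theorem Subalgebra.mem_of_isSimpleModule {F V : Type*} [Field F] [IsAlgClosed F] [AddCommGroup V]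
    [Module F V] [FiniteDimensional F V] (E : Subalgebra F (Module.End F V)) [IsSimpleModule E V]
    (T : Module.End F V) : T ∈ E := by
  classical
  have schur := IsSimpleModule.algebraMap_end_bijective_of_isAlgClosed (A := E) (V := V) F
  let T' : Module.End (Module.End E V) V :=
    { toFun := T
      map_add' := map_add T
      map_smul' := fun f v => by
        obtain ⟨c, rfl⟩ := schur.2 f
        simp }
  let b := Module.finBasis F V
  obtain ⟨r, hr⟩ := jacobson_density (R := E) T' (Finset.univ.image b)
  have : T = r := b.ext fun i => hr (b i) (by simp)
  exact this ▸ r.2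

section GradedSimple

variable {G : Type*} [Group G] [DecidableEq G] {F : Type*} [Field F] {A : Type*} [Ring A]
  [Algebra F A] {𝒜 : G → Submodule F A}

/-- The operators `x ↦ a * x * b` with `a` and `b` homogeneous. -/
def homogeneousSandwich (𝒜 : G → Submodule F A) : Set (Module.End F A) :=
  {T | ∃ α β, ∃ a ∈ 𝒜 α, ∃ b ∈ 𝒜 β, T = LinearMap.mulLeft F a * LinearMap.mulRight F b}

theorem IsGAlgGrading.sandwich_mem_span (hA : IsGAlgGrading F 𝒜) (a b : A) :
    LinearMap.mulLeft F a * LinearMap.mulRight F b ∈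
      Submodule.span F (homogeneousSandwich 𝒜) := by
  have htop := hA.isInternal.submodule_iSup_eq_top
  induction (htop ▸ Submodule.mem_top : a ∈ ⨆ g, 𝒜 g) using Submodule.iSup_induction' with
  | mem α a ha =>
    induction (htop ▸ Submodule.mem_top : b ∈ ⨆ g, 𝒜 g) using Submodule.iSup_induction' with
    | mem β b hb => exact Submodule.subset_span ⟨α, β, a, ha, b, hb, rfl⟩
    | zero => convert Submodule.zero_mem _; ext; simp
    | add b c _ _ hb hc =>
      convert Submodule.add_mem _ hb hc using 1
      ext; simp [mul_add]
  | zero => convert Submodule.zero_mem _; ext; simp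
  | add a c _ _ ha hc =>
    convert Submodule.add_mem _ ha hc using 1
    ext; simp [add_mul]

/-- The projection of a graded algebra onto its component of degree `g`. -/
noncomputable def IsGAlgGrading.proj (hA : IsGAlgGrading F 𝒜) (g : G) : Module.End F A :=
  (𝒜 g).subtype ∘ₗ DirectSum.component F G (fun h => 𝒜 h) g ∘ₗ
    (LinearEquiv.ofBijective (DirectSum.coeLinearMap 𝒜) hA.isInternal).symm.toLinearMap

theorem IsGAlgGrading.proj_mem (hA : IsGAlgGrading F 𝒜) (g : G) (x : A) : hA.proj g x ∈ 𝒜 g :=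
  Subtype.property _

theorem IsGAlgGrading.proj_of_mem (hA : IsGAlgGrading F 𝒜) (g : G) {h : G} {x : A}
    (hx : x ∈ 𝒜 h) : hA.proj g x = if h = g then x else 0 := by
  have key : (LinearEquiv.ofBijective (DirectSum.coeLinearMap 𝒜) hA.isInternal).symm x =
      DirectSum.lof F G (fun h => 𝒜 h) h ⟨x, hx⟩ :=
    (LinearEquiv.symm_apply_eq _).2 (DirectSum.coeLinearMap_lof 𝒜 h ⟨x, hx⟩).symm
  simp only [proj, LinearMap.comp_apply, LinearEquiv.coe_coe, key, DirectSum.component.of]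
  split_ifs with hgh
  · subst hgh; rfl
  · simp

theorem IsGAlgGrading.mem_span_of_proj_mem (hA : IsGAlgGrading F 𝒜) {I : Set A} {x : A}
    (h : ∀ g, hA.proj g x ∈ I) :
    x ∈ Submodule.span F {y : A | (∃ g, y ∈ 𝒜 g) ∧ y ∈ I} := by
  classical
  let e := LinearEquiv.ofBijective (DirectSum.coeLinearMap 𝒜) hA.isInternal
  have hx : x = ∑ g ∈ DFinsupp.support (e.symm x), hA.proj g x := by
    conv_lhs => rw [← e.apply_symm_apply x]
    exact DirectSum.coeLinearMap_eq_dfinsuppSum _ _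
  rw [hx]
  exact Submodule.sum_mem _ fun g _ => Submodule.subset_span ⟨⟨g, hA.proj_mem g x⟩, h g⟩

/-- The algebra generated by all left and right multiplications and all graded projections. -/
noncomputable def IsGAlgGrading.gradedMulAlgebra (hA : IsGAlgGrading F 𝒜) :
    Subalgebra F (Module.End F A) :=
  Algebra.adjoin F (homogeneousSandwich 𝒜 ∪ Set.range hA.proj)

theorem IsGAlgGrading.sandwich_mem_gradedMulAlgebra (hA : IsGAlgGrading F 𝒜) (a b : A) :
    LinearMap.mulLeft F a * LinearMap.mulRight F b ∈ hA.gradedMulAlgebra :=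
  Algebra.adjoin_mono Set.subset_union_left
    (Algebra.span_le_adjoin F _ (hA.sandwich_mem_span a b))

theorem IsGAlgGrading.isSimpleModule (hA : IsGAlgGrading F 𝒜) (hAs : IsGSimpleAlg F 𝒜) :
    IsSimpleModule hA.gradedMulAlgebra A := by
  obtain ⟨⟨a, ha⟩, hAs⟩ := hAs
  have : Nontrivial A := ⟨a, 0, ha⟩
  rw [isSimpleModule_iff]
  refine { eq_bot_or_eq_top := fun N => ?_ }
  have smul_mem {T : Module.End F A} (hT : T ∈ hA.gradedMulAlgebra) {x : A} (hx : x ∈ N) :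
      T x ∈ N := N.smul_mem ⟨T, hT⟩ hx
  let I : TwoSidedIdeal A := TwoSidedIdeal.mk' N N.zero_mem N.add_mem
    (fun hx => by simpa using smul_mem (neg_mem (one_mem _)) hx)
    (fun {x y} hy => by
      simpa using smul_mem (hA.sandwich_mem_gradedMulAlgebra x 1) hy)
    (fun {x y} hx => by
      simpa using smul_mem (hA.sandwich_mem_gradedMulAlgebra 1 y) hx)
  have hI (x : A) : x ∈ I ↔ x ∈ N := TwoSidedIdeal.mem_mk' ..
  have := hAs I fun x hx => hA.mem_span_of_proj_mem (I := I) fun g =>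
    (hI _).2 <| smul_mem (Algebra.subset_adjoin (.inr ⟨g, rfl⟩)) ((hI x).1 hx)
  refine this.imp (fun h => ?_) fun h => ?_
  · ext x
    rw [← hI, h, TwoSidedIdeal.mem_bot, Submodule.mem_bot]
  · ext x
    simp [← hI, h]

theorem IsGAlgGrading.exists_sandwich_eq_of_mem (hA : IsGAlgGrading F 𝒜) {T : Module.End F A}
    (hT : T ∈ hA.gradedMulAlgebra) (g : G) :
    ∃ S ∈ Submodule.span F (homogeneousSandwich 𝒜), ∀ x ∈ 𝒜 g, T x = S x := by
  induction hT using Algebra.adjoin_induction generalizing g with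
  | mem T hT =>
    obtain hT | ⟨h, rfl⟩ := hT
    · exact ⟨T, Submodule.subset_span hT, fun _ _ => rfl⟩
    · by_cases hgh : g = h
      · exact ⟨_, hA.sandwich_mem_span 1 1, fun x hx => by simp [hA.proj_of_mem h hx, hgh]⟩
      · exact ⟨0, Submodule.zero_mem _, fun x hx => by simp [hA.proj_of_mem h hx, hgh]⟩
  | algebraMap r =>
    refine ⟨_, hA.sandwich_mem_span (algebraMap F A r) 1, fun x _ => ?_⟩
    simp [Module.algebraMap_end_apply, Algebra.smul_def]
  | add T U _ _ ihT ihU =>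
    obtain ⟨S, hS, hTS⟩ := ihT g
    obtain ⟨S', hS', hUS⟩ := ihU g
    exact ⟨S + S', Submodule.add_mem _ hS hS', fun x hx => by simp [hTS x hx, hUS x hx]⟩
  | mul T U _ _ ihT ihU =>
    obtain ⟨S, hS, hUS⟩ := ihU g
    have : ∃ S' ∈ Submodule.span F (homogeneousSandwich 𝒜), ∀ x ∈ 𝒜 g, T (S x) = S' x := by
      clear hUS
      induction hS using Submodule.span_induction with
      | mem S hS =>
        obtain ⟨α, β, a, ha, b, hb, rfl⟩ := hS
        obtain ⟨S', hS', hTS⟩ := ihT (α * (g * β))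
        refine ⟨S' * (LinearMap.mulLeft F a * LinearMap.mulRight F b), ?_, fun x hx =>
          hTS _ (hA.mul_mem ha (hA.mul_mem hx hb))⟩
        clear hTS
        induction hS' using Submodule.span_induction with
        | mem S' hS' =>
          obtain ⟨-, -, c, -, d, -, rfl⟩ := hS'
          convert hA.sandwich_mem_span (c * a) (b * d) using 1
          ext; simp [mul_assoc]
        | zero => simp
        | add _ _ _ _ h h' => rw [add_mul]; exact Submodule.add_mem _ h h'
        | smul r _ _ h => rw [smul_mul_assoc]; exact Submodule.smul_mem _ r h
      | zero => exact ⟨0, Submodule.zero_mem _, by simp⟩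
      | add S₁ S₂ _ _ h₁ h₂ =>
        obtain ⟨S₁', hS₁, h₁⟩ := h₁
        obtain ⟨S₂', hS₂, h₂⟩ := h₂
        exact ⟨_, Submodule.add_mem _ hS₁ hS₂, fun x hx => by simp [h₁ x hx, h₂ x hx]⟩
      | smul r S _ h =>
        obtain ⟨S', hS, h⟩ := h
        exact ⟨_, Submodule.smul_mem _ r hS, fun x hx => by simp [h x hx]⟩
    obtain ⟨S', hS', hTS⟩ := this
    exact ⟨S', hS', fun x hx => by rw [Module.End.mul_apply, hUS x hx, hTS x hx]⟩

theorem IsGAlgGrading.exists_sandwich_eq [IsAlgClosed F] [FiniteDimensional F A]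
    (hA : IsGAlgGrading F 𝒜) (hAs : IsGSimpleAlg F 𝒜) (T : Module.End F A) (g : G) :
    ∃ S ∈ Submodule.span F (homogeneousSandwich 𝒜), ∀ x ∈ 𝒜 g, T x = S x :=
  have := hA.isSimpleModule hAs
  hA.exists_sandwich_eq_of_mem (Subalgebra.mem_of_isSimpleModule _ T) g

end GradedSimple

theorem MultilinearMap.exists_mem_ne_zero_of_mem_span {R ι N : Type*} {M : ι → Type*} [Semiring R]
    [Fintype ι] [DecidableEq ι] [∀ i, AddCommMonoid (M i)] [∀ i, Module R (M i)] [AddCommMonoid N]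
    [Module R N] (f : MultilinearMap R M N) (s : ∀ i, Set (M i)) {m : ∀ i, M i}
    (hm : ∀ i, m i ∈ Submodule.span R (s i)) (hf : f m ≠ 0) :
    ∃ m' : ∀ i, M i, (∀ i, m' i ∈ s i) ∧ f m' ≠ 0 := by
  by_contra! hs
  suffices ∀ (t : Finset ι) (m : ∀ i, M i), (∀ i ∈ t, m i ∈ Submodule.span R (s i)) →
      (∀ i ∉ t, m i ∈ s i) → f m = 0 from
    hf (this Finset.univ m (fun i _ => hm i) (by simp))
  intro t
  induction t using Finset.induction_on with
  | empty => exact fun m _ hm => hs m fun i => hm i (by simp)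
  | insert j t hj ih =>
    intro m hm hm'
    suffices ∀ x ∈ Submodule.span R (s j), f (Function.update m j x) = 0 by
      simpa using this _ (hm j (Finset.mem_insert_self j t))
    intro x hx
    induction hx using Submodule.span_induction with
    | mem x hx =>
      refine ih _ (fun i hi => ?_) fun i hi => ?_
      · rw [Function.update_of_ne (by rintro rfl; exact hj hi)]
        exact hm i (Finset.mem_insert_of_mem hi)
      · obtain rfl | hij := eq_or_ne i j
        · simpa
        · rw [Function.update_of_ne hij]
          exact hm' i (by simp [hij, hi])
    | zero => exact f.map_update_zero m j
    | add x y _ _ hx hy => rw [f.map_update_add, hx, hy, add_zero]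
    | smul c x _ hx => rw [f.map_update_smul, hx, smul_zero]

/-- The sign of a permutation preserving the degree function `d`, and zero on all other
permutations. -/
def gradedSign (F : Type*) [Field F] {G : Type*} [DecidableEq G] {N : ℕ} (d : Fin N → G)
    (σ : Equiv.Perm (Fin N)) : F :=
  if ∀ i, d (σ i) = d i then ((Equiv.Perm.sign σ : ℤ) : F) else 0

theorem gradedSign_swap_mul (F : Type*) [Field F] {G : Type*} [DecidableEq G] {N : ℕ}
    {d : Fin N → G} {i j : Fin N} (hij : i ≠ j) (hd : d i = d j) (σ : Equiv.Perm (Fin N)) :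
    gradedSign F d (Equiv.swap i j * σ) = -gradedSign F d σ := by
  have (k : Fin N) : d (Equiv.swap i j k) = d k := by
    rw [Equiv.swap_apply_def]
    split_ifs with h h <;> simp [h, hd]
  simp only [gradedSign, Equiv.Perm.mul_apply, this, Equiv.Perm.sign_mul, Equiv.Perm.sign_swap hij]
  split_ifs <;> simp

theorem IsGAlgGrading.exists_alternating_sum_ne_zero {G : Type*} [Group G] [DecidableEq G]
    {F : Type*} [Field F] [IsAlgClosed F] {A : Type*} [Ring A] [Algebra F A]
    [FiniteDimensional F A] {𝒜 : G → Submodule F A} (hA : IsGAlgGrading F 𝒜)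
    (hAs : IsGSimpleAlg F 𝒜) {N : ℕ} (b : Module.Basis (Fin N) F A) (d : Fin N → G)
    (hb : ∀ i, b i ∈ 𝒜 (d i)) :
    ∃ (α β : Fin N → G) (y z : Fin N → A), (∀ i, y i ∈ 𝒜 (α i)) ∧ (∀ i, z i ∈ 𝒜 (β i)) ∧
      ∑ σ, gradedSign F d σ • (List.ofFn fun i => y i * (b (σ i) * z i)).prod ≠ 0 := by
  have : Nontrivial A := ⟨hAs.1.choose, 0, hAs.1.choose_spec⟩
  choose S hS hTS using fun i : Fin N => hA.exists_sandwich_eq hAs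
    ((LinearMap.toSpanSingleton F A 1).comp (b.coord i)) (d i)
  let f : MultilinearMap F (fun _ : Fin N => Module.End F A) A :=
    ∑ σ, gradedSign F d σ • (MultilinearMap.mkPiAlgebraFin F N A).compLinearMap
      fun i => LinearMap.applyₗ (b (σ i))
  have hf (m : Fin N → Module.End F A) :
      f m = ∑ σ, gradedSign F d σ • (List.ofFn fun i => m i (b (σ i))).prod := by
    simp [f]
  have hfS : f S = 1 := by
    rw [hf, Finset.sum_eq_single 1]
    · have (i : Fin N) : S i (b i) = 1 := by simp [← hTS i _ (hb i)]
      simp [gradedSign, this, List.ofFn_const]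
    · intro σ _ hσ
      by_cases hd : ∀ i, d (σ i) = d i
      · obtain ⟨i, hi⟩ : ∃ i, σ i ≠ i := by
          by_contra! h
          exact hσ (Equiv.ext h)
        have : S i (b (σ i)) = 0 := by
          rw [← hTS i _ (hd i ▸ hb (σ i))]
          simp [hi]
        rw [List.prod_eq_zero, smul_zero]
        exact List.mem_ofFn.2 ⟨i, this⟩
      · simp [gradedSign, hd]
    · simp
  obtain ⟨m, hm, hfm⟩ := f.exists_mem_ne_zero_of_mem_span _ hS (hfS ▸ one_ne_zero)
  choose α β y hy z hz hm using hm
  refine ⟨α, β, y, z, hy, hz, ?_⟩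
  simpa [hf, hm] using hfm

/-- The permutation of `Fin (N * 3)`, viewed as `N` consecutive blocks of size three, which
permutes the middle entries of the blocks by `σ` and fixes the other entries. -/
def middlePerm {N : ℕ} (σ : Equiv.Perm (Fin N)) : Equiv.Perm (Fin (N * 3)) :=
  finProdFinEquiv.permCongr (Equiv.prodCongrLeft fun k : Fin 3 => if k = 1 then σ else 1)

theorem prod_ofFn_middlePerm {M : Type*} [Monoid M] {N : ℕ} (σ : Equiv.Perm (Fin N))
    (f : Fin (N * 3) → M) :
    (List.ofFn fun j => f (middlePerm σ j)).prod =
      (List.ofFn fun i => f (finProdFinEquiv (i, 0)) *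
        (f (finProdFinEquiv (σ i, 1)) * f (finProdFinEquiv (i, 2)))).prod := by
  have key (i : Fin N) (k : Fin 3) (h : (i : ℕ) * 3 + k < N * 3) :
      middlePerm σ ⟨(i : ℕ) * 3 + k, h⟩ = finProdFinEquiv (if k = 1 then σ i else i, k) := by
    have : (⟨(i : ℕ) * 3 + k, h⟩ : Fin (N * 3)) = finProdFinEquiv (i, k) := by
      ext; simp; ring
    rw [this]
    simp only [middlePerm, Equiv.permCongr_apply, Equiv.symm_apply_apply,
      Equiv.prodCongrLeft_apply]
    split_ifs <;> rfl
  rw [List.ofFn_mul, List.prod_flatten, List.map_ofFn]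
  refine congrArg List.prod (congrArg List.ofFn (funext fun i => ?_))
  simp only [Function.comp_apply, key, List.ofFn_succ, List.ofFn_zero, List.prod_cons,
    List.prod_nil, mul_one]
  rfl

/-- The alternating sum of the monomials `∏ i, w (i, 0) * (w (σ i, 1) * w (i, 2))` over the
permutations `σ` preserving the degree function `d`. -/
noncomputable def alternatingPoly (F : Type*) [Field F] {G X : Type*} [DecidableEq G] {N : ℕ}
    (d : Fin N → G) (w : Fin N × Fin 3 → X) : FreeAlgebra F X :=
  ∑ σ, gradedSign F d σ • (List.ofFn fun i => FreeAlgebra.ι F (w (i, 0)) *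
    (FreeAlgebra.ι F (w (σ i, 1)) * FreeAlgebra.ι F (w (i, 2)))).prod

theorem lift_alternatingPoly {F : Type*} [Field F] {G X : Type*} [DecidableEq G] {N : ℕ}
    (d : Fin N → G) (w : Fin N × Fin 3 → X) {B : Type*} [Ring B] [Algebra F B] (f : X → B) :
    FreeAlgebra.lift F f (alternatingPoly F d w) = ∑ σ, gradedSign F d σ •
      (List.ofFn fun i => f (w (i, 0)) * (f (w (σ i, 1)) * f (w (i, 2)))).prod := by
  simp [alternatingPoly, map_list_prod, List.map_ofFn, Function.comp_def]

theorem varSwap_alternatingPoly (F : Type*) [Field F] {G : Type*} [DecidableEq G] {N : ℕ}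
    {d : Fin N → G} {w : Fin N × Fin 3 → ℕ × G} (hw : Function.Injective w) {i j : Fin N}
    (hij : i ≠ j) (hd : d i = d j) :
    varSwap F (w (i, 1)) (w (j, 1)) (alternatingPoly F d w) = -alternatingPoly F d w := by
  have hmid (k : Fin N) :
      Equiv.swap (w (i, 1)) (w (j, 1)) (w (k, 1)) = w (Equiv.swap i j k, 1) :=
    (hw.comp (Prod.mk_left_injective (1 : Fin 3))).swap_apply i j k
  have hfix (k : Fin N) {l : Fin 3} (hl : l ≠ 1) :
      Equiv.swap (w (i, 1)) (w (j, 1)) (w (k, l)) = w (k, l) :=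
    Equiv.swap_apply_of_ne_of_ne (fun h => hl (congrArg Prod.snd (hw h)))
      fun h => hl (congrArg Prod.snd (hw h))
  rw [varSwap, lift_alternatingPoly, alternatingPoly, ← Finset.sum_neg_distrib]
  refine Fintype.sum_equiv (Equiv.mulLeft (Equiv.swap i j)) _ _ fun σ => ?_
  simp [hmid, hfix, gradedSign_swap_mul F hij hd]

/-- A finite-dimensional `G`-simple algebra over an algebraically closed field of
characteristic zero admits a multilinear `G`-graded nonidentity `p` which, for every
`g ∈ G` with `A_g ≠ 0`, alternates in a set `S g` of exactly `dim_F A_g` variables of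
homogeneous degree `g`, these alternating sets being pairwise disjoint. -/
theorem exists_multilinear_alternating_nonidentity
    {G : Type*} [Group G] [DecidableEq G]
    (F : Type*) [Field F] [IsAlgClosed F] [CharZero F]
    {A : Type*} [Ring A] [Algebra F A] [FiniteDimensional F A]
    (𝒜 : G → Submodule F A) (hA : IsGAlgGrading F 𝒜) (hAs : IsGSimpleAlg F 𝒜) :
    ∃ (m : ℕ) (v : Fin m → ℕ × G) (_ : Function.Injective v)
      (c : Equiv.Perm (Fin m) → F) (p : FreeAlgebra F (ℕ × G)),
      -- `p` is multilinear in the variables `v 0, …, v (m-1)`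
      p = ∑ σ : Equiv.Perm (Fin m),
            c σ • (List.ofFn fun i => FreeAlgebra.ι F (v (σ i))).prod ∧
      -- `p` is not a graded identity of `A`
      ¬ IsGradedIdentity F 𝒜 p ∧
      ∃ S : G → Finset (ℕ × G),
        -- the variables of `S g` occur in `p` and have degree `g`
        (∀ g : G, ∀ w ∈ S g, w ∈ Set.range v ∧ w.2 = g) ∧
        -- the alternating sets are pairwise disjoint
        (∀ g g' : G, g ≠ g' → Disjoint (S g) (S g')) ∧
        -- each set has exactly `dim_F A_g` variables
        (∀ g : G, 𝒜 g ≠ ⊥ → (S g).card = Module.finrank F (𝒜 g)) ∧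
        -- `p` alternates in each set `S g`
        (∀ g : G, ∀ a ∈ S g, ∀ b ∈ S g, a ≠ b → varSwap F a b p = -p) := by
  classical
  have : Finite ((g : G) × Fin (Module.finrank F (𝒜 g))) :=
    Module.Finite.finite_basis (hA.isInternal.collectedBasis fun g => Module.finBasis F (𝒜 g))
  obtain ⟨N, ⟨e⟩⟩ := Finite.exists_equiv_fin ((g : G) × Fin (Module.finrank F (𝒜 g)))
  let b := (hA.isInternal.collectedBasis fun g => Module.finBasis F (𝒜 g)).reindex e
  let d : Fin N → G := fun i => (e.symm i).1
  have hb (i : Fin N) : b i ∈ 𝒜 (d i) := by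
    rw [Module.Basis.reindex_apply]
    exact hA.isInternal.collectedBasis_mem _ _
  obtain ⟨α, β, y, z, hy, hz, hne⟩ := hA.exists_alternating_sum_ne_zero hAs b d hb
  let deg : Fin N × Fin 3 → G := fun x => ![α x.1, d x.1, β x.1] x.2
  let val : Fin N × Fin 3 → A := fun x => ![y x.1, b x.1, z x.1] x.2
  have hval (x : Fin N × Fin 3) : val x ∈ 𝒜 (deg x) := by
    obtain ⟨i, k⟩ := x
    fin_cases k
    exacts [hy i, hb i, hz i]
  let v : Fin (N * 3) → ℕ × G := fun j => (j, deg (finProdFinEquiv.symm j))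
  have hv : Function.Injective v := fun i j h => Fin.ext (congrArg Prod.fst h)
  let w : Fin N × Fin 3 → ℕ × G := fun x => v (finProdFinEquiv x)
  have hw : Function.Injective w := hv.comp finProdFinEquiv.injective
  have hw2 (x : Fin N × Fin 3) : (w x).2 = deg x := by simp [w, v]
  refine ⟨N * 3, v, hv, fun τ => ∑ σ, if middlePerm σ = τ then gradedSign F d σ else 0,
    alternatingPoly F d w,
    ?_, ?_, fun g => ({i | d i = g} : Finset (Fin N)).image fun i => w (i, 1), ?_, ?_, ?_, ?_⟩
  · simp_rw [Finset.sum_smul, ite_smul, zero_smul]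
    rw [Finset.sum_comm]
    simp only [Finset.sum_ite_eq, Finset.mem_univ, if_true]
    exact Finset.sum_congr rfl fun σ _ => congrArg _
      (prod_ofFn_middlePerm σ fun j => FreeAlgebra.ι F (v j)).symm
  · intro hp
    refine hne ?_
    have := hp (Function.extend w val 0) fun i g => ?_
    · rw [lift_alternatingPoly] at this
      simpa [hw.extend_apply, val] using this
    · by_cases h : ∃ x, w x = (i, g)
      · obtain ⟨x, hx⟩ := h
        have hg : deg x = g := by rw [← hw2, hx]
        rw [← hx, hw.extend_apply, ← hg]
        exact hval x
      · rw [Function.extend_apply' _ _ _ h]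
        exact Submodule.zero_mem _
  · intro g x hx
    obtain ⟨i, hi, rfl⟩ := Finset.mem_image.1 hx
    exact ⟨⟨_, rfl⟩, (hw2 _).trans (Finset.mem_filter_univ i |>.1 hi)⟩
  · intro g g' hg
    rw [Finset.disjoint_left]
    intro x hx hx'
    obtain ⟨i, hi, rfl⟩ := Finset.mem_image.1 hx
    obtain ⟨j, hj, hij⟩ := Finset.mem_image.1 hx'
    obtain rfl : j = i := congrArg Prod.fst (hw hij)
    simp only [Finset.mem_filter_univ] at hi hj
    exact hg (hi.symm.trans hj)
  · intro g _
    rw [Finset.card_image_of_injective _ fun i j h => congrArg Prod.fst (hw h)]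
    rw [← Fintype.card_subtype, ← Nat.card_eq_fintype_card]
    refine (Nat.card_congr ((e.symm.subtypeEquiv fun i => Iff.rfl).trans
      (Equiv.sigmaSubtype g))).trans (by simp)
  · intro g a ha c hc hac
    obtain ⟨i, hi, rfl⟩ := Finset.mem_image.1 ha
    obtain ⟨j, hj, rfl⟩ := Finset.mem_image.1 hc
    simp only [Finset.mem_filter_univ] at hi hj
    have hij : i ≠ j := fun h => hac (by rw [h])
    exact varSwap_alternatingPoly F hw hij (hi.trans hj.symm)
end

section
/- Let F be an algebraically closed field of characteristic zero, G a group, and let A and B be finite-dimensional G-simple G-graded F-algebras with Id_G(A) = Id_G(B). Then the identity components A_e and B_e (where e is the identity of G) are isomorphic as (ungraded) F-algebras; equivalently, A_e and B_e are semisimple F-algebras whose multisets of dimensions of simple components coincide. -/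
open scoped DirectSum

/-- **Burnside's theorem**: over an algebraically closed field, a transitive algebra of
endomorphisms of a finite-dimensional space is the full endomorphism algebra. -/
theorem Subalgebra.eq_top_of_transitive {F V : Type*} [Field F] [IsAlgClosed F] [AddCommGroup V]
    [Module F V] [FiniteDimensional F V] [Nontrivial V] (N : Subalgebra F (Module.End F V))
    (h : ∀ x : V, x ≠ 0 → ∀ y, ∃ T ∈ N, T x = y) : N = ⊤ := by
  have : IsSimpleModule N V := by
    rw [isSimpleModule_iff_toSpanSingleton_surjective]
    refine ⟨inferInstance, fun x hx y => ?_⟩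
    obtain ⟨T, hT, hTx⟩ := h x hx y
    exact ⟨⟨T, hT⟩, hTx⟩
  rw [eq_top_iff]
  rintro T -
  let f : Module.End (Module.End N V) V :=
    { toFun := T
      map_add' := map_add T
      map_smul' := fun s x => by
        obtain ⟨r, rfl⟩ := (IsSimpleModule.algebraMap_end_bijective_of_isAlgClosed F).2 s
        simp }
  let b := Module.finBasis F V
  classical
  obtain ⟨r, hr⟩ := jacobson_density f (Finset.univ.image b)
  have : T = r.1 := b.ext fun i => hr (b i) (by simp)
  exact this ▸ r.2

/-- **Weak Nullstellensatz**: a nonzero finitely generated commutative algebra over an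
algebraically closed field has a rational point. -/
theorem Algebra.FiniteType.nonempty_algHom_of_isAlgClosed (F S : Type*) [Field F] [IsAlgClosed F]
    [CommRing S] [Nontrivial S] [Algebra F S] [Algebra.FiniteType F S] :
    Nonempty (S →ₐ[F] F) := by
  obtain ⟨m, hm⟩ := Ideal.exists_maximal S
  let := Ideal.Quotient.field m
  have := finite_of_finite_type_of_isJacobsonRing F (S ⧸ m)
  exact ⟨(AlgEquiv.ofBijective (Algebra.ofId F (S ⧸ m))
    IsAlgClosed.algebraMap_bijective_of_isIntegral).symm.toAlgHom.comp (Ideal.Quotient.mkₐ F m)⟩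

/-- An element of an affine domain over an algebraically closed field which vanishes at every
rational point is zero. -/
theorem Algebra.FiniteType.eq_zero_of_forall_algHom {F S : Type*} [Field F] [IsAlgClosed F]
    [CommRing S] [IsDomain S] [Algebra F S] [Algebra.FiniteType F S] (s : S)
    (h : ∀ φ : S →ₐ[F] F, φ s = 0) : s = 0 := by
  by_contra hs
  have : IsDomain (Localization.Away s) :=
    IsLocalization.isDomain_localization (powers_le_nonZeroDivisors_of_noZeroDivisors hs)
  have : Algebra.FiniteType F (Localization.Away s) := inferInstance
  obtain ⟨φ⟩ := nonempty_algHom_of_isAlgClosed F (Localization.Away s)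
  have hu := (IsLocalization.Away.algebraMap_isUnit (S := Localization.Away s) s).map φ
  exact hu.ne_zero (h (φ.comp (IsScalarTower.toAlgHom F S (Localization.Away s))))

/-- Two families of elements of affine domains over an algebraically closed field which satisfy
the same polynomial relations take a common value at suitable rational points. -/
theorem exists_algHom_eq_of_aeval_eq_zero_iff {F S S' L : Type*} [Field F] [IsAlgClosed F]
    [CommRing S] [IsDomain S] [Algebra F S] [Algebra.FiniteType F S]
    [CommRing S'] [IsDomain S'] [Algebra F S'] [Algebra.FiniteType F S'] (c : L → S) (c' : L → S')
    (h : ∀ P : MvPolynomial L F, MvPolynomial.aeval c P = 0 ↔ MvPolynomial.aeval c' P = 0) :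
    ∃ (φ : S →ₐ[F] F) (φ' : S' →ₐ[F] F), ∀ l, φ (c l) = φ' (c' l) := by
  let f := MvPolynomial.aeval (R := F) c
  let R := MvPolynomial L F ⧸ RingHom.ker f
  let g : R →ₐ[F] S := Ideal.kerLiftAlg f
  let g' : R →ₐ[F] S' := Ideal.Quotient.liftₐ _ (MvPolynomial.aeval c') fun P hP => (h P).1 hP
  have hg : Function.Injective g := Ideal.kerLiftAlg_injective f
  have hg' : Function.Injective g' := by
    rw [injective_iff_map_eq_zero]
    intro P
    obtain ⟨P, rfl⟩ := Ideal.Quotient.mk_surjective P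
    intro hP
    exact Ideal.Quotient.eq_zero_iff_mem.2 ((h P).2 hP)
  algebraize [g.toRingHom, g'.toRingHom]
  have : IsScalarTower F R S := .of_algHom g
  have : IsScalarTower F R S' := .of_algHom g'
  have := Algebra.TensorProduct.nontrivial_of_algebraMap_injective_of_isDomain R S S' hg hg'
  have : Algebra.FiniteType R S' := .of_restrictScalars_finiteType F R S'
  have : Algebra.FiniteType F (TensorProduct R S S') := .trans (S := S) ‹_› inferInstance
  obtain ⟨e⟩ := Algebra.FiniteType.nonempty_algHom_of_isAlgClosed F (TensorProduct R S S')
  refine ⟨e.comp Algebra.TensorProduct.includeLeft,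
    e.comp (Algebra.TensorProduct.includeRight.restrictScalars F), fun l => ?_⟩
  let r : R := Ideal.Quotient.mk _ (MvPolynomial.X l)
  have h1 : algebraMap R S r = c l := MvPolynomial.aeval_X c l
  have h2 : algebraMap R S' r = c' l := MvPolynomial.aeval_X c' l
  have h3 : (c l) ⊗ₜ[R] (1 : S') = (1 : S) ⊗ₜ[R] c' l := by
    rw [← h1, ← h2]
    exact Algebra.TensorProduct.tmul_one_eq_one_tmul r
  exact congrArg e h3

/-- The alternating sum `∑ σ, sign σ • ∏ i, ∑ k, y i k * x (σ i) * y' i k`, as an alternating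
map in `x`. -/
noncomputable def alternatingSandwich (F : Type*) {R : Type*} [Field F] [Ring R] [Algebra F R]
    {n : ℕ} {m : Fin n → ℕ} (y y' : (i : Fin n) → Fin (m i) → R) : R [⋀^Fin n]→ₗ[F] R :=
  ((MultilinearMap.mkPiAlgebraFin F n R).compLinearMap
    fun i => ∑ k, LinearMap.mulLeftRight F (y i k, y' i k)).alternatization

theorem alternatingSandwich_apply {F R : Type*} [Field F] [Ring R] [Algebra F R]
    {n : ℕ} {m : Fin n → ℕ} (y y' : (i : Fin n) → Fin (m i) → R) (x : Fin n → R) :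
    alternatingSandwich F y y' x = ∑ σ : Equiv.Perm (Fin n), Equiv.Perm.sign σ •
      (List.ofFn fun i => ∑ k, y i k * x (σ i) * y' i k).prod := by
  simp [alternatingSandwich, MultilinearMap.alternatization_apply]

theorem map_alternatingSandwich {F R R' : Type*} [Field F] [Ring R] [Algebra F R]
    [Ring R'] [Algebra F R'] (φ : R →ₐ[F] R')
    {n : ℕ} {m : Fin n → ℕ} (y y' : (i : Fin n) → Fin (m i) → R) (x : Fin n → R) :
    φ (alternatingSandwich F y y' x) =
      alternatingSandwich F (fun i k => φ (y i k)) (fun i k => φ (y' i k)) fun i => φ (x i) := by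
  simp [alternatingSandwich_apply, Units.smul_def, map_list_prod, List.map_ofFn,
    Function.comp_def]

theorem alternatingSandwich_eq_one {F R : Type*} [Field F] [Ring R] [Algebra F R]
    {n : ℕ} {m : Fin n → ℕ} (y y' : (i : Fin n) → Fin (m i) → R) (x : Fin n → R)
    (h : ∀ i j, ∑ k, y i k * x j * y' i k = if i = j then 1 else 0) :
    alternatingSandwich F y y' x = 1 := by
  have h' : ∀ i j, ∑ k, y i k * x j * y' i k = algebraMap F R ((1 : Matrix _ _ F) j i) := by
    intro i j
    simp [h, Matrix.one_apply, eq_comm, apply_ite (algebraMap F R)]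
  have : ∀ σ : Equiv.Perm (Fin n), (List.ofFn fun i => ∑ k, y i k * x (σ i) * y' i k).prod =
      algebraMap F R (∏ i, (1 : Matrix _ _ F) (σ i) i) := by
    intro σ
    rw [← List.prod_ofFn, map_list_prod, List.map_ofFn]
    simp [h', Function.comp_def]
  rw [alternatingSandwich_apply]
  simp_rw [this]
  rw [← map_one (algebraMap F R), ← Matrix.det_one (n := Fin n), Matrix.det_apply]
  simp [Units.smul_def]

/-- An alternating map of top degree scales by a coordinate when one basis vector is replaced. -/
theorem AlternatingMap.map_update_basis {F V W ι : Type*} [Field F] [AddCommGroup V] [Module F V]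
    [AddCommGroup W] [Module F W] [Fintype ι] [DecidableEq ι] (f : V [⋀^ι]→ₗ[F] W)
    (b : Module.Basis ι F V) (k : ι) (v : V) :
    f (Function.update b k v) = b.repr v k • f b := by
  conv_lhs => rw [← b.sum_repr v]
  rw [AlternatingMap.map_update_sum, Finset.sum_eq_single k]
  · rw [AlternatingMap.map_update_smul, Function.update_eq_self]
  · intro j _ hj
    rw [AlternatingMap.map_update_smul, AlternatingMap.map_update_self _ _ hj.symm, smul_zero]
  · simp

/-- The coordinate ring of `GL n`, with its universal invertible matrix. -/
theorem exists_universal_invertible_matrix.{u} (F : Type u) [Field F] (n : ℕ) :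
    ∃ (S : Type u) (_ : CommRing S) (_ : IsDomain S) (_ : Algebra F S)
      (_ : Algebra.FiniteType F S) (M M' : Matrix (Fin n) (Fin n) S), M * M' = 1 ∧ M' * M = 1 ∧
      ∀ T T' : Matrix (Fin n) (Fin n) F, T * T' = 1 → ∃ φ : S →ₐ[F] F, M.map φ = T := by
  let X := Matrix.mvPolynomialX (Fin n) (Fin n) F
  have hX : X.det ≠ 0 := Matrix.det_mvPolynomialX_ne_zero (Fin n) F
  let S := Localization.Away X.det
  let M : Matrix (Fin n) (Fin n) S := X.map (algebraMap _ S)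
  have hM : IsUnit M.det := by
    have := IsLocalization.Away.algebraMap_isUnit (S := S) X.det
    rwa [RingHom.map_det] at this
  refine ⟨S, inferInstance,
    IsLocalization.isDomain_localization (powers_le_nonZeroDivisors_of_noZeroDivisors hX),
    inferInstance, inferInstance, M, M⁻¹, M.mul_nonsing_inv hM, M.nonsing_inv_mul hM, ?_⟩
  intro T T' hT
  have hT' : IsUnit (MvPolynomial.aeval (fun p : Fin n × Fin n => T p.1 p.2) X.det) := by
    rw [AlgHom.map_det]
    have : AlgHom.mapMatrix (MvPolynomial.aeval fun p : Fin n × Fin n => T p.1 p.2) X = T := by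
      ext; simp [X]
    rw [this]
    exact (Matrix.isUnit_iff_isUnit_det T).1 (.of_mul_eq_one _ hT)
  refine ⟨IsLocalization.liftAlgHom (M := Submonoid.powers X.det)
    (f := MvPolynomial.aeval fun p : Fin n × Fin n => T p.1 p.2) ?_, ?_⟩
  · rintro ⟨_, k, rfl⟩
    simpa using hT'.pow k
  · ext i j
    simp [M, X]

/-- The structure constants of an algebra with respect to a basis. -/
noncomputable def Module.Basis.structureConstant {F E ι : Type*} [Field F] [Ring E] [Algebra F E]
    (b : Module.Basis ι F E) (l : ι × ι × ι) : F :=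
  b.repr (b l.1 * b l.2.1) l.2.2

/-- Algebras with bases having the same structure constants are isomorphic. -/
noncomputable def AlgEquiv.ofStructureConstantEq {F E E' ι : Type*} [Field F] [Ring E]
    [Algebra F E] [Ring E'] [Algebra F E'] (b : Module.Basis ι F E) (b' : Module.Basis ι F E')
    (h : ∀ l, b.structureConstant l = b'.structureConstant l) : E ≃ₐ[F] E' :=
  have hmul : ∀ x y, b.equiv b' (.refl ι) (x * y) =
      b.equiv b' (.refl ι) x * b.equiv b' (.refl ι) y := by
    refine LinearMap.map_mul_iff (b.equiv b' (.refl ι)).toLinearMap |>.2 ?_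
    refine b.ext fun i => b.ext fun j => ?_
    apply b'.repr.injective
    ext k
    simpa [Module.Basis.structureConstant, Module.Basis.equiv] using h (i, j, k)
  AlgEquiv.ofLinearEquiv (b.equiv b' (.refl ι))
    (by
      obtain ⟨z, hz⟩ := (b.equiv b' (.refl ι)).surjective 1
      rw [← mul_one (b.equiv b' (.refl ι) 1), ← hz, ← hmul, one_mul]) hmul

/-- The structure constants of all bases of an algebra are the values at the rational points of
`GL n` of a family of regular functions. -/
theorem exists_structureConstant_family {F E S : Type*} [Field F] [Ring E] [Algebra F E]
    [CommRing S] [Algebra F S] {n : ℕ} (M M' : Matrix (Fin n) (Fin n) S) (hM : M * M' = 1)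
    (hM' : M' * M = 1)
    (hS : ∀ T T' : Matrix (Fin n) (Fin n) F, T * T' = 1 → ∃ φ : S →ₐ[F] F, M.map φ = T)
    (b₀ : Module.Basis (Fin n) F E) :
    ∃ c : Fin n × Fin n × Fin n → S,
      (∀ φ : S →ₐ[F] F, ∃ b : Module.Basis (Fin n) F E, ∀ l, φ (c l) = b.structureConstant l) ∧
      ∀ b : Module.Basis (Fin n) F E, ∃ φ : S →ₐ[F] F, ∀ l, φ (c l) = b.structureConstant l := by
  let c : Fin n × Fin n × Fin n → S := fun l => ∑ r, M' l.2.2 r * ∑ p, ∑ q,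
    M p l.1 * M q l.2.1 * algebraMap F S (b₀.structureConstant (p, q, r))
  have key : ∀ φ : S →ₐ[F] F, ∃ b : Module.Basis (Fin n) F E,
      (∀ i, b i = ∑ p, M.map φ p i • b₀ p) ∧ ∀ l, φ (c l) = b.structureConstant l := by
    intro φ
    have h₁ : M.map φ * M'.map φ = 1 := by
      simpa using congrArg (AlgHom.mapMatrix φ) hM
    have h₂ : M'.map φ * M.map φ = 1 := by
      simpa using congrArg (AlgHom.mapMatrix φ) hM'
    let b := b₀.map (Matrix.toLinOfInv b₀ b₀ h₁ h₂)
    have hb : ∀ i, b i = ∑ p, M.map φ p i • b₀ p := by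
      intro i
      simp [b, Matrix.toLinOfInv, Matrix.toLin_self]
    have hr : ∀ v k, b.repr v k = ∑ r, M'.map φ k r * b₀.repr v r := by
      intro v k
      have : b.repr v k = b₀.repr (Matrix.toLin b₀ b₀ (M'.map φ) v) k := rfl
      rw [this, ← LinearMap.toMatrix_mulVec_repr b₀ b₀, LinearMap.toMatrix_toLin]
      rfl
    refine ⟨b, hb, fun l => ?_⟩
    rw [Module.Basis.structureConstant, hr, hb, hb]
    simp only [c, map_sum, map_mul, AlgHom.commutes, Algebra.algebraMap_self_apply,
      Finset.sum_mul_sum, Finsupp.coe_finsetSum, Finset.sum_apply, smul_mul_smul_comm, map_smul,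
      Finsupp.coe_smul, Pi.smul_apply, smul_eq_mul, Matrix.map_apply,
      Module.Basis.structureConstant]
  refine ⟨c, fun φ => (key φ).imp fun b h => h.2, fun b => ?_⟩
  obtain ⟨φ, hφ⟩ := hS (b₀.toMatrix b) (b.toMatrix b₀) (b₀.toMatrix_mul_toMatrix_flip b)
  obtain ⟨b', hb', h⟩ := key φ
  have : b' = b := Module.Basis.eq_of_apply_eq fun i => by
    rw [hb', hφ, Module.Basis.sum_toMatrix_smul_self]
  exact ⟨φ, this ▸ h⟩

namespace IsGAlgGrading

variable {G F A : Type*} [Group G] [DecidableEq G] [Field F] [Ring A] [Algebra F A]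
  {𝒜 : G → Submodule F A}

/-- The projection onto a homogeneous component. -/
noncomputable def proj_s10 (hA : IsGAlgGrading F 𝒜) (g : G) : A →ₗ[F] A :=
  (𝒜 g).subtype ∘ₗ DirectSum.component F G (fun g => 𝒜 g) g ∘ₗ
    (LinearEquiv.ofBijective (DirectSum.coeLinearMap 𝒜) hA.isInternal).symm.toLinearMap

theorem symm_apply_of_mem (hA : IsGAlgGrading F 𝒜) {g : G} {x : A} (hx : x ∈ 𝒜 g) :
    (LinearEquiv.ofBijective (DirectSum.coeLinearMap 𝒜) hA.isInternal).symm x =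
      DirectSum.lof F G (fun g => 𝒜 g) g ⟨x, hx⟩ := by
  rw [LinearEquiv.symm_apply_eq]
  exact (DirectSum.coeLinearMap_lof 𝒜 g ⟨x, hx⟩).symm

theorem proj_mem_s10 (hA : IsGAlgGrading F 𝒜) (g : G) (x : A) : hA.proj_s10 g x ∈ 𝒜 g :=
  Submodule.coe_mem _

theorem proj_of_mem_s10 (hA : IsGAlgGrading F 𝒜) {g : G} {x : A} (hx : x ∈ 𝒜 g) :
    hA.proj_s10 g x = x := by
  simp [proj_s10, hA.symm_apply_of_mem hx]

theorem proj_of_mem_of_ne (hA : IsGAlgGrading F 𝒜) {g h : G} {x : A} (hx : x ∈ 𝒜 h)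
    (hne : h ≠ g) : hA.proj_s10 g x = 0 := by
  simp [proj_s10, hA.symm_apply_of_mem hx, DirectSum.component.of, hne]

theorem induction (hA : IsGAlgGrading F 𝒜) {p : A → Prop} (x : A)
    (mem : ∀ g, ∀ x ∈ 𝒜 g, p x) (add : ∀ x y, p x → p y → p (x + y)) : p x :=
  Submodule.iSup_induction 𝒜 (motive := p) (hA.isInternal.submodule_iSup_eq_top ▸ Submodule.mem_top) mem
    (mem 1 0 (zero_mem _)) add

theorem proj_mul (hA : IsGAlgGrading F 𝒜) {h : G} {a : A} (ha : a ∈ 𝒜 h) (r : A) :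
    hA.proj_s10 h (r * a) = hA.proj_s10 1 r * a := by
  induction r using hA.induction with
  | mem g r hr =>
    by_cases hg : g = 1
    · subst hg
      rw [hA.proj_of_mem_s10 hr, hA.proj_of_mem_s10 (by simpa using hA.mul_mem hr ha)]
    · rw [hA.proj_of_mem_of_ne hr hg, hA.proj_of_mem_of_ne (hA.mul_mem hr ha) (by simpa using hg),
        zero_mul]
  | add x y hx hy => simp [add_mul, hx, hy]

theorem one_mem (hA : IsGAlgGrading F 𝒜) : (1 : A) ∈ 𝒜 1 := by
  have h : ∀ r : A, hA.proj_s10 1 1 * r = r := fun r => by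
    induction r using hA.induction with
    | mem g r hr => rw [← hA.proj_mul hr, one_mul, hA.proj_of_mem_s10 hr]
    | add x y hx hy => rw [mul_add, hx, hy]
  rw [← h 1, mul_one]
  exact hA.proj_mem_s10 1 1

/-- The identity component of a graded algebra, as a subalgebra. -/
def identityComponent (hA : IsGAlgGrading F 𝒜) : Subalgebra F A :=
  (𝒜 1).toSubalgebra hA.one_mem fun a b ha hb => by simpa using hA.mul_mem ha hb

theorem mem_identityComponent (hA : IsGAlgGrading F 𝒜) {a : A} :
    a ∈ hA.identityComponent ↔ a ∈ 𝒜 1 := Iff.rfl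

/-- In a graded-simple algebra, the identity component is generated by any of its nonzero elements
under the sandwich operators `z ↦ a * z * b` with `a`, `b` homogeneous of inverse degrees. -/
theorem mem_span_sandwich (hA : IsGAlgGrading F 𝒜) (hAs : IsGSimpleAlg F 𝒜) {x y : A}
    (hx : x ∈ 𝒜 1) (hx0 : x ≠ 0) (hy : y ∈ 𝒜 1) :
    y ∈ Submodule.span F {z | ∃ g, ∃ a ∈ 𝒜 g, ∃ b ∈ 𝒜 g⁻¹, z = a * x * b} := by
  let W : Submodule F A := Submodule.span F {z | ∃ g h, ∃ a ∈ 𝒜 g, ∃ b ∈ 𝒜 h, z = a * x * b}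
  have hl : ∀ r z : A, z ∈ W → r * z ∈ W := by
    intro r z hz
    induction r using hA.induction with
    | mem k r hr =>
      refine Submodule.span_induction (p := fun z _ => r * z ∈ W) ?_ (by simp)
        (fun u v _ _ hu hv => by simpa [mul_add] using add_mem hu hv)
        (fun t u _ hu => by simpa using W.smul_mem t hu) hz
      rintro _ ⟨g, h, a, ha, b, hb, rfl⟩
      exact Submodule.subset_span ⟨k * g, h, r * a, hA.mul_mem hr ha, b, hb, by simp [mul_assoc]⟩
    | add u v hu hv => simpa [add_mul] using add_mem hu hv
  have hr : ∀ z r : A, z ∈ W → z * r ∈ W := by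
    intro z r hz
    induction r using hA.induction with
    | mem k r hr =>
      refine Submodule.span_induction (p := fun z _ => z * r ∈ W) ?_ (by simp)
        (fun u v _ _ hu hv => by simpa [add_mul] using add_mem hu hv)
        (fun t u _ hu => by simpa using W.smul_mem t hu) hz
      rintro _ ⟨g, h, a, ha, b, hb, rfl⟩
      exact Submodule.subset_span ⟨g, h * k, a, ha, b * r, hA.mul_mem hb hr, by simp [mul_assoc]⟩
    | add u v hu hv => simpa [mul_add] using add_mem hu hv
  let I : TwoSidedIdeal A := .mk' W W.zero_mem W.add_mem W.neg_mem (hl _ _) (hr _ _)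
  have hI : ∀ z, z ∈ I ↔ z ∈ W := fun z => TwoSidedIdeal.mem_mk' ..
  have htop : I = ⊤ := by
    refine (hAs.2 I fun z hz => ?_).resolve_left fun hbot => hx0 ?_
    · refine Submodule.span_mono ?_ ((hI z).1 hz)
      rintro _ ⟨g, h, a, ha, b, hb, rfl⟩
      refine ⟨⟨g * 1 * h, hA.mul_mem (hA.mul_mem ha hx) hb⟩, (hI _).2 ?_⟩
      exact Submodule.subset_span ⟨g, h, a, ha, b, hb, rfl⟩
    · have : x ∈ I := (hI x).2 <|
        Submodule.subset_span ⟨1, 1, 1, hA.one_mem, 1, hA.one_mem, by simp⟩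
      rwa [hbot, TwoSidedIdeal.mem_bot] at this
  have hyW : y ∈ W := (hI y).1 (htop ▸ TwoSidedIdeal.mem_top A)
  have := Submodule.mem_map_of_mem (f := hA.proj_s10 1) hyW
  rw [hA.proj_of_mem_s10 hy, Submodule.map_span] at this
  refine Submodule.span_le.2 ?_ this
  rintro _ ⟨_, ⟨g, h, a, ha, b, hb, rfl⟩, rfl⟩
  have hab : a * x * b ∈ 𝒜 (g * h) := by simpa using hA.mul_mem (hA.mul_mem ha hx) hb
  by_cases hgh : g * h = 1
  · rw [hA.proj_of_mem_s10 (hgh ▸ hab)]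
    exact Submodule.subset_span ⟨g, a, ha, b, inv_eq_of_mul_eq_one_right hgh ▸ hb, rfl⟩
  · rw [hA.proj_of_mem_of_ne hab hgh]
    exact zero_mem _

/-- In a graded-simple algebra over an algebraically closed field, every endomorphism of the
identity component is a sum of sandwich operators. -/
theorem exists_eq_sum_sandwich [IsAlgClosed F] [FiniteDimensional F A] (hA : IsGAlgGrading F 𝒜)
    (hAs : IsGSimpleAlg F 𝒜) (T : Module.End F hA.identityComponent) :
    ∃ (m : ℕ) (d : Fin m → G) (y y' : Fin m → A), (∀ k, y k ∈ 𝒜 (d k)) ∧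
      (∀ k, y' k ∈ 𝒜 (d k)⁻¹) ∧ ∀ z, (T z : A) = ∑ k, y k * z * y' k := by
  let N₀ : Submonoid (Module.End F hA.identityComponent) :=
    { carrier := {T | ∃ g, ∃ a ∈ 𝒜 g, ∃ b ∈ 𝒜 g⁻¹, ∀ z, (T z : A) = a * z * b}
      one_mem' := ⟨1, 1, hA.one_mem, 1, by simpa using hA.one_mem, by simp⟩
      mul_mem' := by
        rintro S T ⟨g, a, ha, b, hb, hS⟩ ⟨h, a', ha', b', hb', hT⟩
        refine ⟨g * h, a * a', hA.mul_mem ha ha', b' * b, ?_, fun z => ?_⟩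
        · simpa using hA.mul_mem hb' hb
        · simp [hS, hT, mul_assoc] }
  obtain ⟨a, ha⟩ := hAs.1
  have : Nontrivial A := nontrivial_of_ne a 0 ha
  have hN : Algebra.adjoin F (N₀ : Set (Module.End F hA.identityComponent)) = ⊤ := by
    refine Subalgebra.eq_top_of_transitive _ fun x hx y => ?_
    suffices ∃ T ∈ Algebra.adjoin F (N₀ : Set (Module.End F hA.identityComponent)),
        (T x : A) = y from this.imp fun T h => ⟨h.1, Subtype.ext h.2⟩
    refine Submodule.span_induction (p := fun y _ =>
      ∃ T ∈ Algebra.adjoin F (N₀ : Set (Module.End F hA.identityComponent)), (T x : A) = y)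
      ?_ ⟨0, zero_mem _, by simp⟩ ?_ ?_ (hA.mem_span_sandwich hAs x.2 (by simpa using hx) y.2)
    · rintro _ ⟨g, a, ha, b, hb, rfl⟩
      refine ⟨((LinearMap.mulLeftRight F (a, b)).comp
        hA.identityComponent.val.toLinearMap).codRestrict
          (Subalgebra.toSubmodule hA.identityComponent) fun z => ?_, ?_, rfl⟩
      · have := hA.mul_mem (hA.mul_mem ha (hA.mem_identityComponent.1 z.2)) hb
        rw [mul_one, mul_inv_cancel] at this
        exact this
      · exact Algebra.subset_adjoin ⟨g, a, ha, b, hb, fun z => rfl⟩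
    · rintro _ _ _ _ ⟨S, hS, rfl⟩ ⟨T, hT, rfl⟩
      exact ⟨S + T, add_mem hS hT, by simp⟩
    · rintro t _ _ ⟨S, hS, rfl⟩
      exact ⟨t • S, Subalgebra.smul_mem _ hS t, by simp⟩
  have hT : T ∈ Submodule.span F (N₀ : Set (Module.End F hA.identityComponent)) := by
    rw [← N₀.closure_eq, ← Algebra.adjoin_eq_span, hN]
    trivial
  obtain ⟨m, t, S, rfl⟩ := Submodule.mem_span_set'.1 hT
  choose d y hy y' hy' hS using fun k => (S k).2
  refine ⟨m, d, fun k => t k • y k, y', fun k => (𝒜 _).smul_mem _ (hy k), hy', fun z => ?_⟩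
  simp [hS]

end IsGAlgGrading

theorem isGradedIdentity_transfer {G F A B κ : Type*} [Group G] [Field F] [Ring A] [Algebra F A]
    [Ring B] [Algebra F B] [Countable κ] {𝒜 : G → Submodule F A} {ℬ : G → Submodule F B}
    (hId : ∀ p, IsGradedIdentity F ℬ p → IsGradedIdentity F 𝒜 p) (deg : κ → G)
    (q : FreeAlgebra F κ)
    (hq : ∀ v : κ → B, (∀ k, v k ∈ ℬ (deg k)) → FreeAlgebra.lift F v q = 0)
    (v : κ → A) (hv : ∀ k, v k ∈ 𝒜 (deg k)) : FreeAlgebra.lift F v q = 0 := by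
  obtain ⟨enc, henc⟩ := exists_injective_nat κ
  let j : κ → ℕ × G := fun k => (enc k, deg k)
  have hj : Function.Injective j := fun a b h => henc (congrArg Prod.fst h)
  let ρ : FreeAlgebra F κ →ₐ[F] FreeAlgebra F (ℕ × G) :=
    FreeAlgebra.lift F fun k => FreeAlgebra.ι F (j k)
  have hρB : ∀ w : ℕ × G → B, FreeAlgebra.lift F w (ρ q) = FreeAlgebra.lift F (w ∘ j) q := by
    intro w
    rw [← AlgHom.comp_apply]
    congr 1
    ext k
    simp [ρ]
  have hρA : ∀ w : ℕ × G → A, FreeAlgebra.lift F w (ρ q) = FreeAlgebra.lift F (w ∘ j) q := by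
    intro w
    rw [← AlgHom.comp_apply]
    congr 1
    ext k
    simp [ρ]
  have := hId (ρ q) (fun w hw => by rw [hρB]; exact hq _ fun k => hw _ _)
    (Function.extend j v 0) fun i g => ?_
  · rwa [hρA, Function.extend_comp hj] at this
  · by_cases h : ∃ k, j k = (i, g)
    · obtain ⟨k, hk⟩ := h
      rw [← hk, hj.extend_apply]
      have : deg k = g := congrArg Prod.snd hk
      exact this ▸ hv k
    · rw [Function.extend_apply' _ _ _ h]
      exact zero_mem _

/-- Homogenization: `P (c) • f ^ (N + 1)` is polynomial in `f` and the products `c l • f`. -/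
theorem exists_homogenization {F R A B L : Type*} [Field F] [Ring R] [Algebra F R] [Ring A]
    [Algebra F A] [Ring B] [Algebra F B] (f : R) (f' : L → R) (P : MvPolynomial L F) :
    ∃ (q : R) (N : ℕ),
      (∀ ψ : R →ₐ[F] A, (ψ f = 0 → ψ q = 0) ∧ ∀ c : L → F, (∀ l, ψ (f' l) = c l • ψ f) →
        ψ q = MvPolynomial.aeval c P • ψ f ^ (N + 1)) ∧
      ∀ ψ : R →ₐ[F] B, (ψ f = 0 → ψ q = 0) ∧ ∀ c : L → F, (∀ l, ψ (f' l) = c l • ψ f) →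
        ψ q = MvPolynomial.aeval c P • ψ f ^ (N + 1) := by
  induction P using MvPolynomial.induction_on with
  | C a => exact ⟨a • f, 0, by simp +contextual, by simp +contextual⟩
  | add P Q hP hQ =>
    obtain ⟨p, M, hp, hp'⟩ := hP
    obtain ⟨q, N, hq, hq'⟩ := hQ
    refine ⟨p * f ^ (N + 1) + q * f ^ (M + 1), M + N + 1, fun ψ => ?_, fun ψ => ?_⟩
    · refine ⟨fun h => by simp [h], fun c hc => ?_⟩
      rw [map_add, map_mul, map_mul, (hp ψ).2 c hc, (hq ψ).2 c hc, map_add, add_smul, map_pow,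
        map_pow, smul_mul_assoc, smul_mul_assoc, ← pow_add, ← pow_add]
      congr 3 <;> ring
    · refine ⟨fun h => by simp [h], fun c hc => ?_⟩
      rw [map_add, map_mul, map_mul, (hp' ψ).2 c hc, (hq' ψ).2 c hc, map_add, add_smul, map_pow,
        map_pow, smul_mul_assoc, smul_mul_assoc, ← pow_add, ← pow_add]
      congr 3 <;> ring
  | mul_X P l hP =>
    obtain ⟨p, M, hp, hp'⟩ := hP
    refine ⟨p * f' l, M + 1, fun ψ => ?_, fun ψ => ?_⟩
    · refine ⟨fun h => by simp [(hp ψ).1 h], fun c hc => ?_⟩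
      rw [map_mul, (hp ψ).2 c hc, hc, smul_mul_smul_comm, ← pow_succ, map_mul,
        MvPolynomial.aeval_X]
    · refine ⟨fun h => by simp [(hp' ψ).1 h], fun c hc => ?_⟩
      rw [map_mul, (hp' ψ).2 c hc, hc, smul_mul_smul_comm, ← pow_succ, map_mul,
        MvPolynomial.aeval_X]

theorem alternatingSandwich_update_mul {F R : Type*} [Field F] [Ring R] [Algebra F R]
    {n : ℕ} {m : Fin n → ℕ} (y y' : (i : Fin n) → Fin (m i) → R) (E : Subalgebra F R)
    (b : Module.Basis (Fin n) F E) (l : Fin n × Fin n × Fin n) :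
    alternatingSandwich F y y' (Function.update (fun i => (b i : R)) l.2.2 (b l.1 * b l.2.1)) =
      b.structureConstant l • alternatingSandwich F y y' fun i => (b i : R) := by
  have := ((alternatingSandwich F y y').compLinearMap E.val.toLinearMap).map_update_basis b l.2.2
    (b l.1 * b l.2.1)
  refine Eq.trans ?_ this
  rw [AlternatingMap.compLinearMap_apply]
  congr 1
  ext i
  by_cases h : i = l.2.2
  · subst h; simp
  · simp [h]

theorem alternatingSandwich_eq_zero {F R : Type*} [Field F] [Ring R] [Algebra F R]
    {n : ℕ} {m : Fin n → ℕ} (y y' : (i : Fin n) → Fin (m i) → R) (E : Subalgebra F R)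
    [FiniteDimensional F E] (hE : Module.finrank F E ≤ n) (x : Fin n → R) (hx : ∀ i, x i ∈ E)
    (hb : ¬ ∃ b : Module.Basis (Fin n) F E, ∀ i, (b i : R) = x i) :
    alternatingSandwich F y y' x = 0 := by
  let z : Fin n → E := fun i => ⟨x i, hx i⟩
  refine ((alternatingSandwich F y y').compLinearMap E.val.toLinearMap).map_linearDependent z
    fun hz => hb ?_
  have hcard : Fintype.card (Fin n) = Module.finrank F E :=
    le_antisymm hz.fintype_card_le_finrank (by simpa using hE)
  have hspan := hz.span_eq_top_of_card_eq_finrank' hcard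
  exact ⟨.mk hz hspan.ge, fun i => by simp [z]⟩

/-- If the graded identities of `B` hold in `A`, where `A` is graded-simple, then the polynomial
relations between structure constants of the identity component of `B` hold for `A`. -/
theorem aeval_structureConstant_eq_zero {G F A B : Type*} [Group G] [DecidableEq G] [Field F]
    [IsAlgClosed F] [Ring A] [Algebra F A] [Ring B] [Algebra F B] [FiniteDimensional F A]
    [FiniteDimensional F B] {𝒜 : G → Submodule F A} {ℬ : G → Submodule F B}
    (hA : IsGAlgGrading F 𝒜) (hB : IsGAlgGrading F ℬ) (hAs : IsGSimpleAlg F 𝒜)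
    (hId : ∀ p, IsGradedIdentity F ℬ p → IsGradedIdentity F 𝒜 p) {n : ℕ}
    (hn : Module.finrank F hB.identityComponent ≤ n) (P : MvPolynomial (Fin n × Fin n × Fin n) F)
    (hP : ∀ b : Module.Basis (Fin n) F hB.identityComponent,
      MvPolynomial.aeval b.structureConstant P = 0)
    (b : Module.Basis (Fin n) F hA.identityComponent) :
    MvPolynomial.aeval b.structureConstant P = 0 := by
  obtain ⟨a, ha⟩ := hAs.1
  have : Nontrivial A := nontrivial_of_ne a 0 ha
  choose m d y y' hy hy' hT using fun i =>
    hA.exists_eq_sum_sandwich hAs ((b.coord i).smulRight 1)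
  let κ := Fin n ⊕ (Σ i, Fin (m i)) ⊕ (Σ i, Fin (m i))
  let deg : κ → G := Sum.elim (fun _ => 1) (Sum.elim (fun k => d k.1 k.2) fun k => (d k.1 k.2)⁻¹)
  let X : Fin n → FreeAlgebra F κ := fun i => FreeAlgebra.ι F (.inl i)
  let f : (Fin n → FreeAlgebra F κ) → FreeAlgebra F κ := alternatingSandwich F
    (fun i k => FreeAlgebra.ι F (.inr (.inl ⟨i, k⟩)))
    (fun i k => FreeAlgebra.ι F (.inr (.inr ⟨i, k⟩)))
  let f' : Fin n × Fin n × Fin n → FreeAlgebra F κ := fun l =>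
    f (Function.update X l.2.2 (X l.1 * X l.2.1))
  obtain ⟨q, N, hqA, hqB⟩ := exists_homogenization (A := A) (B := B) (f X) f' P
  have hq : ∀ w : κ → B, (∀ k, w k ∈ ℬ (deg k)) → FreeAlgebra.lift F w q = 0 := by
    intro w hw
    by_cases hb : ∃ b : Module.Basis (Fin n) F hB.identityComponent, ∀ i, (b i : B) = w (.inl i)
    · obtain ⟨b, hb⟩ := hb
      rw [(hqB _).2 b.structureConstant, hP, zero_smul]
      intro l
      simp only [f', f, map_alternatingSandwich, X, FreeAlgebra.lift_ι_apply, ← hb]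
      rw [← alternatingSandwich_update_mul]
      congr 1
      ext i
      by_cases h : i = l.2.2
      · subst h; simp [hb]
      · simp [h, hb]
    · refine (hqB _).1 ?_
      simp only [f, map_alternatingSandwich, X, FreeAlgebra.lift_ι_apply]
      exact alternatingSandwich_eq_zero _ _ hB.identityComponent hn _ (fun i => hw (.inl i)) hb
  let v : κ → A := Sum.elim (fun i => b i) (Sum.elim (fun k => y k.1 k.2) fun k => y' k.1 k.2)
  have hv : ∀ k, v k ∈ 𝒜 (deg k) := by
    rintro (i | k | k)
    · exact (b i).2
    · exact hy _ _
    · exact hy' _ _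
  have h1 : FreeAlgebra.lift F v (f X) = 1 := by
    simp only [f, map_alternatingSandwich, X, FreeAlgebra.lift_ι_apply]
    refine alternatingSandwich_eq_one _ _ _ fun i j => ?_
    refine (hT i (b j)).symm.trans ?_
    by_cases h : i = j <;> simp [h]
  have h0 := isGradedIdentity_transfer hId deg q hq v hv
  rw [(hqA _).2 b.structureConstant, h1, one_pow] at h0
  · simpa using h0
  · intro l
    simp only [f', f, map_alternatingSandwich, X, FreeAlgebra.lift_ι_apply]
    refine Eq.trans ?_ (alternatingSandwich_update_mul _ _ _ b l)
    congr 1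
    ext i
    by_cases h : i = l.2.2
    · subst h; simp [v]
    · simp [h, v]

theorem finrank_identityComponent_le {G F A B : Type*} [Group G] [DecidableEq G] [Field F]
    [IsAlgClosed F] [Ring A] [Algebra F A] [Ring B] [Algebra F B] [FiniteDimensional F A]
    [FiniteDimensional F B] {𝒜 : G → Submodule F A} {ℬ : G → Submodule F B}
    (hA : IsGAlgGrading F 𝒜) (hB : IsGAlgGrading F ℬ) (hAs : IsGSimpleAlg F 𝒜)
    (hId : ∀ p, IsGradedIdentity F ℬ p → IsGradedIdentity F 𝒜 p) :
    Module.finrank F hA.identityComponent ≤ Module.finrank F hB.identityComponent := by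
  by_contra! hlt
  have := aeval_structureConstant_eq_zero hA hB hAs hId hlt.le 1
    (fun b => absurd (Module.finrank_eq_card_basis b) (by simpa using hlt.ne))
    (Module.finBasis F hA.identityComponent)
  simp at this

/-- If `A` and `B` are finite-dimensional `G`-simple graded algebras over an algebraically
closed field of characteristic zero satisfying the same `G`-graded identities, then their
identity components `A_e` and `B_e` are isomorphic as (ungraded) `F`-algebras: there is an
`F`-linear multiplicative bijection `A_e ≃ B_e`. -/
theorem identityComponent_iso_of_same_gradedIdentities
    {G : Type*} [Group G] [DecidableEq G]
    (F : Type*) [Field F] [IsAlgClosed F] [CharZero F]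
    {A B : Type*} [Ring A] [Algebra F A] [Ring B] [Algebra F B]
    [FiniteDimensional F A] [FiniteDimensional F B]
    (𝒜 : G → Submodule F A) (ℬ : G → Submodule F B)
    (hA : IsGAlgGrading F 𝒜) (hB : IsGAlgGrading F ℬ)
    (hAs : IsGSimpleAlg F 𝒜) (hBs : IsGSimpleAlg F ℬ)
    (hId : ∀ p : FreeAlgebra F (ℕ × G), IsGradedIdentity F 𝒜 p ↔ IsGradedIdentity F ℬ p) :
    ∃ e : (𝒜 (1 : G)) ≃ₗ[F] (ℬ (1 : G)),
      ∀ (x y : 𝒜 (1 : G)) (hxy : (x : A) * (y : A) ∈ 𝒜 (1 : G)),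
        (e ⟨(x : A) * (y : A), hxy⟩ : B) = (e x : B) * (e y : B) := by
  let n := Module.finrank F hA.identityComponent
  have hn : Module.finrank F hB.identityComponent = n :=
    le_antisymm (finrank_identityComponent_le hB hA hBs fun p => (hId p).1)
      (finrank_identityComponent_le hA hB hAs fun p => (hId p).2)
  obtain ⟨S, _, _, _, _, M, M', hM, hM', hS⟩ := exists_universal_invertible_matrix F n
  obtain ⟨c, hc, hc'⟩ := exists_structureConstant_family M M' hM hM' hS
    (Module.finBasis F hA.identityComponent)
  obtain ⟨c', hd, hd'⟩ := exists_structureConstant_family M M' hM hM' hS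
    (Module.finBasisOfFinrankEq F hB.identityComponent hn)
  obtain ⟨φ, φ', h⟩ := exists_algHom_eq_of_aeval_eq_zero_iff c c' fun P => by
    constructor <;> intro hP <;>
      refine Algebra.FiniteType.eq_zero_of_forall_algHom (F := F) _ fun φ => ?_ <;>
      rw [MvPolynomial.comp_aeval_apply]
    · obtain ⟨b', hb'⟩ := hd φ
      rw [funext hb']
      refine aeval_structureConstant_eq_zero hB hA hBs (fun p => (hId p).1) le_rfl P
        (fun b => ?_) b'
      obtain ⟨φ, hφ⟩ := hc' b
      rw [← funext hφ, ← MvPolynomial.comp_aeval_apply, hP, map_zero]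
    · obtain ⟨b, hb⟩ := hc φ
      rw [funext hb]
      refine aeval_structureConstant_eq_zero hA hB hAs (fun p => (hId p).2) hn.le P
        (fun b' => ?_) b
      obtain ⟨φ, hφ⟩ := hd' b'
      rw [← funext hφ, ← MvPolynomial.comp_aeval_apply, hP, map_zero]
  obtain ⟨b, hb⟩ := hc φ
  obtain ⟨b', hb'⟩ := hd φ'
  let e := AlgEquiv.ofStructureConstantEq b b' fun l => by rw [← hb, ← hb', h]
  refine ⟨e.toLinearEquiv, fun x y hxy => ?_⟩
  exact congrArg Subtype.val (map_mul e (⟨x, x.2⟩ : hA.identityComponent) ⟨y, y.2⟩)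
end
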